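/- arXiv:2406.04860 — 2 statements merged into one kernel-verified Lean document; each statement's English description precedes it below -/
import Mathlib

section
/- For every ρ ∈ (0, 1/2] there exists a constant c > 0 (depending only on ρ) such that for every integer k ≥ 2, l_k(1/k + ρ) ≥ c · ln k. -/
/-- The (natural-log) binary entropy function, with the convention `h 0 = h 1 = 0`
(which holds automatically since `Real.log 0 = 0`). -/
noncomputable def binEnt (β : ℝ) : ℝ := -β * Real.log β - (1 - β) * Real.log (1 - β)

/-- The function `l_k(β) = ln k - h(β) - (1-β) ln(k-1)`. -/
noncomputable def lfun (k : ℕ) (β : ℝ) : ℝ :=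
  Real.log k - binEnt β - (1 - β) * Real.log ((k : ℝ) - 1)

theorem binEnt_eq_binEntropy (β : ℝ) : binEnt β = Real.binEntropy β := by
  simp only [binEnt, Real.binEntropy, Real.log_inv]
  ring

theorem lfun_eq_log_sub_qaryEntropy (k : ℕ) (β : ℝ) :
    lfun k β = Real.log k - Real.qaryEntropy k (1 - β) := by
  rw [lfun, Real.qaryEntropy, binEnt_eq_binEntropy, Real.binEntropy_one_sub]
  push_cast
  ring

theorem qaryEntropy_one_sub_one_div (k : ℕ) (hk : 2 ≤ k) :
    Real.qaryEntropy k (1 - 1 / (k : ℝ)) = Real.log k := by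
  have hk' : (2 : ℝ) ≤ k := by exact_mod_cast hk
  have h0 : (k : ℝ) ≠ 0 := by positivity
  have h1 : (k : ℝ) - 1 ≠ 0 := by linarith
  have h2 : 1 - 1 / (k : ℝ) = (k - 1) / k := by field_simp
  rw [Real.qaryEntropy, Real.binEntropy_one_sub, Real.binEntropy, Real.log_inv, Real.log_inv,
    h2, Real.log_div h1 h0, one_div, Real.log_inv]
  push_cast
  field_simp
  ring

theorem one_div_add_le_one {ρ : ℝ} (hρ : ρ ≤ 1 / 2) {k : ℕ} (hk : 2 ≤ k) :
    1 / (k : ℝ) + ρ ≤ 1 := by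
  have hk' : (2 : ℝ) ≤ k := by exact_mod_cast hk
  have := one_div_le_one_div_of_le two_pos hk'
  linarith

theorem lfun_pos {ρ : ℝ} (hρ₁ : 0 < ρ) (hρ₂ : ρ ≤ 1 / 2) {k : ℕ} (hk : 2 ≤ k) :
    0 < lfun k (1 / (k : ℝ) + ρ) := by
  have hβ := one_div_add_le_one hρ₂ hk
  have hk0 : (0 : ℝ) ≤ 1 / k := by positivity
  have h := Real.qaryEntropy_strictMonoOn hk (a := 1 - (1 / (k : ℝ) + ρ)) (b := 1 - 1 / (k : ℝ))
    ⟨by linarith, by linarith⟩ ⟨by linarith, le_rfl⟩ (by linarith)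
  rw [qaryEntropy_one_sub_one_div k hk] at h
  rw [lfun_eq_log_sub_qaryEntropy]
  linarith

theorem mul_log_sub_log_two_le_lfun {ρ : ℝ} (hρ₂ : ρ ≤ 1 / 2) {k : ℕ} (hk : 2 ≤ k) :
    ρ * Real.log k - Real.log 2 ≤ lfun k (1 / (k : ℝ) + ρ) := by
  have hβ := one_div_add_le_one hρ₂ hk
  have hk' : (2 : ℝ) ≤ k := by exact_mod_cast hk
  have hlog : Real.log ((k : ℝ) - 1) ≤ Real.log k := Real.log_le_log (by linarith) (by linarith)
  have hlog0 : 0 ≤ Real.log k := Real.log_nonneg (by linarith)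
  have hH : Real.binEntropy (1 / (k : ℝ) + ρ) ≤ Real.log 2 := Real.binEntropy_le_log_two
  have h1 := mul_le_mul_of_nonneg_left hlog (sub_nonneg.2 hβ)
  have h2 : 0 ≤ 1 / (k : ℝ) * Real.log k := by positivity
  rw [lfun, binEnt_eq_binEntropy]
  linarith

theorem exists_pos_forall_lt_mul_log_le {f : ℕ → ℝ} (hf : ∀ k, 2 ≤ k → 0 < f k) (N : ℕ) :
    ∃ c : ℝ, 0 < c ∧ ∀ k : ℕ, 2 ≤ k → k < N → c * Real.log k ≤ f k := by
  induction N with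
  | zero => exact ⟨1, one_pos, fun k _ h => absurd h (Nat.not_lt_zero k)⟩
  | succ N ih =>
    obtain ⟨c, hc, h⟩ := ih
    by_cases hN : 2 ≤ N
    · have hlog : 0 < Real.log N := Real.log_pos (by exact_mod_cast hN)
      refine ⟨min c (f N / Real.log N), lt_min hc (div_pos (hf N hN) hlog), fun k hk hkN => ?_⟩
      rcases Nat.lt_succ_iff_lt_or_eq.1 hkN with hlt | rfl
      · exact (mul_le_mul_of_nonneg_right (min_le_left _ _) (Real.log_natCast_nonneg k)).trans
          (h k hk hlt)
      · exact (le_div_iff₀ hlog).1 (min_le_right _ _)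
    · exact ⟨c, hc, fun k hk hkN => by omega⟩

/-- For every `ρ ∈ (0, 1/2]` there is a constant `c > 0` (depending
only on `ρ`) such that `l_k(1/k + ρ) ≥ c ln k` for every integer `k ≥ 2`. -/
theorem stmt_5 (ρ : ℝ) (hρ₁ : 0 < ρ) (hρ₂ : ρ ≤ 1 / 2) :
    ∃ c : ℝ, 0 < c ∧ ∀ k : ℕ, 2 ≤ k → c * Real.log k ≤ lfun k (1 / (k : ℝ) + ρ) := by
  obtain ⟨N, hN⟩ := Filter.eventually_atTop.1
    ((Real.tendsto_log_atTop.comp tendsto_natCast_atTop_atTop).eventually_ge_atTop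
      (2 * Real.log 2 / ρ))
  obtain ⟨c, hc, h⟩ := exists_pos_forall_lt_mul_log_le
    (f := fun k => lfun k (1 / (k : ℝ) + ρ)) (fun _ hk => lfun_pos hρ₁ hρ₂ hk) N
  refine ⟨min c (ρ / 2), lt_min hc (half_pos hρ₁), fun k hk => ?_⟩
  have hlog : 0 ≤ Real.log k := Real.log_natCast_nonneg k
  rcases lt_or_ge k N with hkN | hkN
  · exact (mul_le_mul_of_nonneg_right (min_le_left _ _) hlog).trans (h k hk hkN)
  · refine (mul_le_mul_of_nonneg_right (min_le_right _ _) hlog).trans ?_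
    have h1 : 2 * Real.log 2 ≤ Real.log k * ρ := (div_le_iff₀ hρ₁).1 (hN k hkN)
    have h2 := mul_log_sub_log_two_le_lfun hρ₂ hk
    linarith
end

section
/- Let k ≥ 2, t ≥ 1, n ≥ 1 be integers, let d > 0 and ε ∈ (0,1) with (d/n)(1 + ε/2) ≤ 1. Let f_1, …, f_t : [k] → {−1,+1} be fixed functions such that for all distinct q, q' ∈ [k], | #{ℓ ∈ [t] : f_ℓ(q) = f_ℓ(q')} − t/2 | ≤ t^{3/4}/2. Fix distinct q, q' ∈ [k], and let E_1, …, E_t be mutually independent events with P(E_ℓ) = (d/n)·(1 + (ε/2)·f_ℓ(q)·f_ℓ(q')). Then P(E_1 ∪ ⋯ ∪ E_t) ≥ (dt/n)·(1 − t^{−1/4} − 2dt/n). Moreover, if instead P(E_ℓ) = (d/n)·(1 + ε/2) for every ℓ ∈ [t] (the case of two equal community labels, where f_ℓ(q)·f_ℓ(q) = 1), then P(E_1 ∪ ⋯ ∪ E_t) ≤ (1 + ε/2)·dt/n. -/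
open MeasureTheory ProbabilityTheory

theorem Finset.prod_one_sub_le_one_sub_sum_add_sq {ι : Type*} (s : Finset ι) (p : ι → ℝ)
    (h0 : ∀ i ∈ s, 0 ≤ p i) (h1 : ∀ i ∈ s, p i ≤ 1) :
    ∏ i ∈ s, (1 - p i) ≤ 1 - ∑ i ∈ s, p i + (∑ i ∈ s, p i) ^ 2 / 2 := by
  classical
  induction s using Finset.induction_on with
  | empty => simp
  | insert a s ha ih =>
    rw [Finset.prod_insert ha, Finset.sum_insert ha]
    have ih' := ih (fun i hi => h0 i (Finset.mem_insert_of_mem hi))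
      (fun i hi => h1 i (Finset.mem_insert_of_mem hi))
    have ha0 := h0 a (Finset.mem_insert_self a s)
    have ha1 := h1 a (Finset.mem_insert_self a s)
    have hmul := mul_le_mul_of_nonneg_left ih' (sub_nonneg.2 ha1)
    nlinarith [mul_nonneg ha0 (sq_nonneg (∑ i ∈ s, p i)), sq_nonneg (p a)]

theorem ProbabilityTheory.iIndepSet.measureReal_iUnion {ι Ω : Type*} [Fintype ι]
    [MeasurableSpace Ω] {μ : Measure Ω} [IsProbabilityMeasure μ] {E : ι → Set Ω}
    (mE : ∀ i, MeasurableSet (E i)) (hE : iIndepSet E μ) :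
    μ.real (⋃ i, E i) = 1 - ∏ i, (1 - μ.real (E i)) := by
  have hcompl : μ (⋂ i, (E i)ᶜ) = ∏ i, μ (E i)ᶜ :=
    iIndep.meas_iInter hE fun i =>
      (MeasurableSpace.measurableSet_generateFrom (Set.mem_singleton _)).compl
  have hreal : μ.real (⋂ i, (E i)ᶜ) = ∏ i, (1 - μ.real (E i)) := by
    rw [measureReal_def, hcompl, ENNReal.toReal_prod]
    exact Finset.prod_congr rfl fun i _ => probReal_compl_eq_one_sub (mE i)
  rw [← hreal, ← Set.compl_iUnion, probReal_compl_eq_one_sub (MeasurableSet.iUnion mE)]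
  ring

theorem ProbabilityTheory.iIndepSet.sum_sub_sq_le_measureReal_iUnion {ι Ω : Type*} [Fintype ι]
    [MeasurableSpace Ω] {μ : Measure Ω} [IsProbabilityMeasure μ] {E : ι → Set Ω}
    (mE : ∀ i, MeasurableSet (E i)) (hE : iIndepSet E μ) :
    ∑ i, μ.real (E i) - (∑ i, μ.real (E i)) ^ 2 / 2 ≤ μ.real (⋃ i, E i) := by
  rw [hE.measureReal_iUnion mE]
  have := Finset.univ.prod_one_sub_le_one_sub_sum_add_sq (fun i => μ.real (E i))
    (fun _ _ => measureReal_nonneg) (fun _ _ => measureReal_le_one)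
  linarith

theorem sum_mul_eq_two_mul_card_agree_sub {ι : Type*} [Fintype ι] (u v : ι → ℝ)
    (hu : ∀ i, u i = 1 ∨ u i = -1) (hv : ∀ i, v i = 1 ∨ v i = -1) :
    ∑ i, u i * v i =
      2 * ((Finset.univ.filter fun i => u i = v i).card : ℝ) - Fintype.card ι := by
  have h : ∀ i, u i * v i = 2 * (if u i = v i then 1 else 0) - 1 := fun i => by
    rcases hu i with h | h <;> rcases hv i with h' | h' <;> rw [h, h'] <;> norm_num
  simp_rw [h, Finset.sum_sub_distrib, ← Finset.mul_sum, Finset.sum_boole]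
  simp

/-- Fix `k ≥ 2`, `t ≥ 1`, `n ≥ 1`, `d > 0`, `ε ∈ (0,1)` with
`(d/n)(1+ε/2) ≤ 1`, and fixed functions `f₁, …, f_t : [k] → {-1,+1}` whose pairwise
agreement counts are all within `t^{3/4}/2` of `t/2`.  Fix distinct `q, q' ∈ [k]` and
mutually independent events `E₁, …, E_t`.  If `P(E_ℓ) = (d/n)(1 + (ε/2) f_ℓ(q) f_ℓ(q'))`
for each `ℓ`, then `P(⋃ E_ℓ) ≥ (dt/n)(1 - t^{-1/4} - 2dt/n)`; if instead
`P(E_ℓ) = (d/n)(1 + ε/2)` for each `ℓ`, then `P(⋃ E_ℓ) ≤ (1 + ε/2) dt/n`. -/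
theorem stmt_11 (k t n : ℕ) (hk : 2 ≤ k) (ht : 1 ≤ t) (hn : 1 ≤ n)
    (d ε : ℝ) (hd : 0 < d) (hε : ε ∈ Set.Ioo (0 : ℝ) 1)
    (hdn : d / n * (1 + ε / 2) ≤ 1)
    (f : Fin t → Fin k → ℝ) (hf : ∀ ℓ q, f ℓ q = 1 ∨ f ℓ q = -1)
    (hconc : ∀ q q' : Fin k, q ≠ q' →
      |((Finset.univ.filter fun ℓ : Fin t => f ℓ q = f ℓ q').card : ℝ) - t / 2| ≤
        (t : ℝ) ^ ((3 : ℝ) / 4) / 2)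
    (q q' : Fin k) (hqq' : q ≠ q')
    {Ω : Type*} [MeasurableSpace Ω] (μ : Measure Ω) [IsProbabilityMeasure μ]
    (E : Fin t → Set Ω) (mE : ∀ ℓ, MeasurableSet (E ℓ))
    (hind : iIndepSet E μ) :
    ((∀ ℓ, (μ (E ℓ)).toReal = d / n * (1 + ε / 2 * (f ℓ q * f ℓ q'))) →
      d * t / n * (1 - (t : ℝ) ^ (-(1 : ℝ) / 4) - 2 * d * t / n) ≤
        (μ (⋃ ℓ, E ℓ)).toReal) ∧
    ((∀ ℓ, (μ (E ℓ)).toReal = d / n * (1 + ε / 2)) →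
      (μ (⋃ ℓ, E ℓ)).toReal ≤ (1 + ε / 2) * (d * t / n)) := by
  have hn0 : (0 : ℝ) < n := by exact_mod_cast hn
  have ht0 : (0 : ℝ) < t := by exact_mod_cast ht
  obtain ⟨hε0, hε1⟩ := hε
  refine ⟨fun hE => ?_, fun hE => ?_⟩
  · have hlow := hind.sum_sub_sq_le_measureReal_iUnion mE
    have hsum : ∑ ℓ, μ.real (E ℓ) = d / n * (t + ε / 2 * ∑ ℓ, f ℓ q * f ℓ q') := by
      simp_rw [measureReal_def, hE, ← Finset.mul_sum, Finset.sum_add_distrib, ← Finset.mul_sum]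
      simp
    have hD := sum_mul_eq_two_mul_card_agree_sub (fun ℓ => f ℓ q) (fun ℓ => f ℓ q')
      (fun ℓ => hf ℓ q) (fun ℓ => hf ℓ q')
    rw [Fintype.card_fin] at hD
    have hpow : (t : ℝ) ^ ((3 : ℝ) / 4) = t * (t : ℝ) ^ (-(1 : ℝ) / 4) := by
      rw [← Real.rpow_one_add' ht0.le (by norm_num)]
      norm_num
    have hr1 : (t : ℝ) ^ (-(1 : ℝ) / 4) ≤ 1 :=
      Real.rpow_le_one_of_one_le_of_nonpos (by exact_mod_cast ht) (by norm_num)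
    have hr0 : 0 < (t : ℝ) ^ (-(1 : ℝ) / 4) := Real.rpow_pos_of_pos ht0 _
    have hc := abs_le.1 (hconc q q' hqq')
    rw [hpow] at hc
    change _ ≤ μ.real (⋃ ℓ, E ℓ)
    refine le_trans ?_ hlow
    set r := (t : ℝ) ^ (-(1 : ℝ) / 4)
    set D := ∑ ℓ, f ℓ q * f ℓ q'
    set x := d * t / n with hx
    have hx0 : 0 < x := by positivity
    have hx2 : 2 * d * t / n = 2 * x := by rw [hx]; ring
    have hD1 : -(t * r) ≤ D := by linarith [hc.1]
    have hD2 : D ≤ t * r := by linarith [hc.2]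
    obtain ⟨y, hy⟩ : ∃ y, y = D / t := ⟨_, rfl⟩
    have hy1 : -r ≤ y := by rw [hy, le_div_iff₀ ht0]; linarith
    have hy2 : y ≤ r := by rw [hy, div_le_iff₀ ht0]; linarith
    have hS : ∑ ℓ, μ.real (E ℓ) = x * (1 + ε / 2 * y) := by
      rw [hsum, hx, hy]; field_simp
    have hl : -r ≤ ε / 2 * y := by nlinarith
    have hu : ε / 2 * y ≤ 1 / 2 := by nlinarith
    rw [hS, hx2]
    have hsq : (1 + ε / 2 * y) ^ 2 ≤ 4 := by nlinarith
    nlinarith [mul_le_mul_of_nonneg_left hl hx0.le,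
      mul_le_mul_of_nonneg_left hsq (sq_nonneg x)]
  · change μ.real (⋃ ℓ, E ℓ) ≤ _
    refine (measureReal_iUnion_fintype_le E).trans (le_of_eq ?_)
    simp_rw [measureReal_def, hE]
    simp
    ring
end
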